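/- Let s : ℕ → ℕ be defined by the recursion s(0) = 0 and s(N) = (N mod 3) + s(2·⌊N/3⌋) for N ≥ 1 (this recursion is well-founded since 2·⌊N/3⌋ < N for N ≥ 1). Then for every natural number N and every base-3/2 representation ds of N with all digits at most 2, the sum of the entries of ds equals s(N). In particular the sum-of-digits function s_{3/2} of base 3/2 satisfies s_{3/2}(3N + r) = s_{3/2}(2N) + r for r = 0, 1, 2, i.e., s_{3/2} is the fixed point starting with 0 of the 2-3-block substitution a,b ↦ a, a+1, a+2 on the alphabet ℕ. -/

import Mathlib

/-- `ds` is a base-3/2 representation of the natural number `N`. -/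
def IsBase32Rep (N : ℕ) (ds : List ℕ) : Prop :=
  (∀ d ∈ ds, d ≤ 2) ∧
    (N : ℚ) = ∑ i ∈ Finset.range ds.length, (ds.getD i 0 : ℚ) * (3 / 2 : ℚ) ^ i

/-- The sum-of-digits function of base 3/2: `s 0 = 0` and
`s N = (N % 3) + s (2 * (N / 3))` for `N ≥ 1`. -/
def s : ℕ → ℕ
  | 0 => 0
  | (N + 1) => ((N + 1) % 3) + s (2 * ((N + 1) / 3))
decreasing_by omega

theorem s_eq (N : ℕ) : s N = N % 3 + s (2 * (N / 3)) := by
  cases N with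
  | zero => simp [s]
  | succ n => rw [s]

theorem s_three_mul_add (N r : ℕ) (hr : r ≤ 2) : s (3 * N + r) = s (2 * N) + r := by
  have hmod : (3 * N + r) % 3 = r := by omega
  have hdiv : (3 * N + r) / 3 = N := by omega
  rw [s_eq, hmod, hdiv, add_comm]

/-- The value of a digit list in base 3/2, split at its least significant digit. -/
theorem sum_range_base32_cons (d : ℕ) (ds : List ℕ) :
    ∑ i ∈ Finset.range (d :: ds).length, ((d :: ds).getD i 0 : ℚ) * (3 / 2 : ℚ) ^ i =
      d + 3 / 2 * ∑ i ∈ Finset.range ds.length, (ds.getD i 0 : ℚ) * (3 / 2 : ℚ) ^ i := by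
  rw [List.length_cons, Finset.sum_range_succ', Finset.mul_sum, add_comm]
  congr 1
  · simp
  · refine Finset.sum_congr rfl fun i _ => ?_
    rw [List.getD_cons_succ, pow_succ]
    ring

/-- The value of a digit list in base 3/2 is a natural number divided by a power of two. -/
theorem exists_two_pow_mul_sum_range_base32 (ds : List ℕ) :
    ∃ a : ℕ, (2 : ℚ) ^ ds.length *
      ∑ i ∈ Finset.range ds.length, (ds.getD i 0 : ℚ) * (3 / 2 : ℚ) ^ i = a := by
  induction ds with
  | nil => exact ⟨0, by simp⟩
  | cons d ds ih =>
    obtain ⟨a, ha⟩ := ih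
    refine ⟨2 ^ (ds.length + 1) * d + 3 * a, ?_⟩
    rw [sum_range_base32_cons, List.length_cons]
    push_cast
    rw [← ha, pow_succ]
    ring

/-- Removing the least significant digit `d` of a base-3/2 representation of `N` leaves a
representation of the natural number `2 * (N - d) / 3`. -/
theorem IsBase32Rep.exists_tail {N d : ℕ} {ds : List ℕ} (h : IsBase32Rep N (d :: ds)) :
    ∃ M : ℕ, IsBase32Rep M ds ∧ 3 * M + 2 * d = 2 * N := by
  obtain ⟨hd, hN⟩ := h
  rw [sum_range_base32_cons] at hN
  obtain ⟨a, ha⟩ := exists_two_pow_mul_sum_range_base32 ds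
  set S := ∑ i ∈ Finset.range ds.length, (ds.getD i 0 : ℚ) * (3 / 2 : ℚ) ^ i
  have hS3 : 3 * S = 2 * N - 2 * d := by linarith
  have key : (3 * a + 2 ^ ds.length * (2 * d) : ℕ) = 2 ^ ds.length * (2 * N) := by
    have : (3 * a + 2 ^ ds.length * (2 * d) : ℚ) = 2 ^ ds.length * (2 * N) := by
      rw [← ha]
      linear_combination (2 : ℚ) ^ ds.length * hS3
    exact_mod_cast this
  have hdvd : 2 ^ ds.length ∣ a := by
    have h3 : 2 ^ ds.length ∣ 3 * a :=
      (Nat.dvd_add_left (Dvd.intro _ rfl)).1 (key ▸ Dvd.intro _ rfl)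
    exact (Nat.Coprime.pow_left _ (by norm_num)).dvd_of_dvd_mul_left h3
  obtain ⟨M, rfl⟩ := hdvd
  have hSM : S = M := by
    push_cast at ha
    exact mul_left_cancel₀ (by positivity) ha
  refine ⟨M, ⟨fun x hx => hd x (List.mem_cons_of_mem _ hx), hSM.symm⟩, ?_⟩
  rw [hSM] at hS3
  have : (3 * M + 2 * d : ℚ) = 2 * N := by linarith
  exact_mod_cast this

theorem IsBase32Rep.sum_eq {N : ℕ} {ds : List ℕ} (h : IsBase32Rep N ds) : ds.sum = s N := by
  induction ds generalizing N with
  | nil =>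
    have hN : N = 0 := by simpa [IsBase32Rep] using h
    simp [hN, s]
  | cons d ds ih =>
    have hd : d ≤ 2 := h.1 d List.mem_cons_self
    obtain ⟨M, hM, hMN⟩ := h.exists_tail
    obtain ⟨K, rfl⟩ : ∃ K, M = 2 * K := ⟨M / 2, by omega⟩
    obtain rfl : N = 3 * K + d := by omega
    rw [List.sum_cons, ih hM, s_three_mul_add K d hd, add_comm]

/-- The sum of the digits of any base-3/2 representation of `N` equals `s N`;
in particular `s` satisfies `s (3N + r) = s (2N) + r` for `r = 0, 1, 2`,
i.e., `s` is the fixed point starting with `0` of the 2-3-block substitution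
`a, b ↦ a, a+1, a+2` on the alphabet `ℕ`. -/
theorem sumDigits_base32 :
    (∀ (N : ℕ) (ds : List ℕ), IsBase32Rep N ds → ds.sum = s N) ∧
      (∀ N r : ℕ, r ≤ 2 → s (3 * N + r) = s (2 * N) + r) := by
  exact ⟨fun _ _ h => h.sum_eq, s_three_mul_add⟩
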